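/- Let d ≥ 1 be an integer and 0 < α < min(2,d). Then Ψ_{α,d}(σ) tends to +∞ as σ tends to −α from the right. -/

import Mathlib

open Real Filter

/-- `Ψ_{α,d}(σ) = -2^α Γ((σ+α)/2) Γ((d-σ)/2) / (Γ((d-σ-α)/2) Γ(σ/2))` for `σ ≠ 0`,
and `Ψ_{α,d}(0) = 0`. -/
noncomputable def Psi (α d σ : ℝ) : ℝ :=
  if σ = 0 then 0
  else -(2 ^ α) * (Real.Gamma ((σ + α) / 2) * Real.Gamma ((d - σ) / 2)) /
    (Real.Gamma ((d - σ - α) / 2) * Real.Gamma (σ / 2))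

/-- The Gamma function is continuous wherever it does not vanish. -/
theorem continuousAt_Gamma_of_ne_zero {x : ℝ} (hx : Real.Gamma x ≠ 0) :
    ContinuousAt Real.Gamma x :=
  (Real.differentiableAt_Gamma fun m hm => hx ((Real.Gamma_eq_zero_iff x).mpr ⟨m, hm⟩)).continuousAt

/-- The Gamma function tends to `+∞` at `0` from the right. -/
theorem Gamma_tendsto_atTop_nhdsGT_zero :
    Tendsto Real.Gamma (nhdsWithin 0 (Set.Ioi 0)) atTop := by
  have hc : Tendsto (fun x : ℝ => Real.Gamma (x + 1)) (nhdsWithin 0 (Set.Ioi 0)) (nhds 1) := by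
    have h : ContinuousAt (fun x : ℝ => Real.Gamma (x + 1)) 0 := by
      refine ContinuousAt.comp (g := Real.Gamma) ?_ (by fun_prop)
      exact continuousAt_Gamma_of_ne_zero (Real.Gamma_pos_of_pos (by norm_num)).ne'
    have h' := h.tendsto.mono_left (nhdsWithin_le_nhds (s := Set.Ioi 0))
    simpa using h'
  refine (tendsto_inv_nhdsGT_zero.atTop_mul_pos one_pos hc).congr' ?_
  filter_upwards [self_mem_nhdsWithin] with x hx
  have hx : (0 : ℝ) < x := hx
  rw [Real.Gamma_add_one hx.ne']
  field_simp

/-- The Gamma function is negative on `(-1, 0)`. -/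
theorem Gamma_neg_of_neg_one_lt_of_neg {x : ℝ} (h : -1 < x) (hx : x < 0) : Real.Gamma x < 0 := by
  have h1 : 0 < Real.Gamma (x + 1) := Real.Gamma_pos_of_pos (by linarith)
  rw [Real.Gamma_add_one hx.ne] at h1
  exact neg_of_mul_pos_right h1 hx.le

/-- For an integer `d ≥ 1` and `0 < α < min(2,d)`, the function `Ψ_{α,d}(σ)` tends to `+∞`
as `σ` tends to `-α` from the right. -/
theorem psi_tendsto_atTop (d : ℕ) (hd : 1 ≤ d) (α : ℝ) (hα : 0 < α)
    (hα2 : α < min 2 (d : ℝ)) :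
    Tendsto (Psi α d) (nhdsWithin (-α) (Set.Ioi (-α))) atTop := by
  obtain ⟨hα2, hαd⟩ := lt_min_iff.mp hα2
  have hGneg : Real.Gamma (-α / 2) < 0 :=
    Gamma_neg_of_neg_one_lt_of_neg (by linarith) (by linarith)
  have hGd : 0 < Real.Gamma ((d - -α - α) / 2) := Real.Gamma_pos_of_pos (by linarith)
  have hGdα : 0 < Real.Gamma ((d - -α) / 2) := Real.Gamma_pos_of_pos (by linarith)
  have hnum : ContinuousAt (fun σ : ℝ => Real.Gamma ((d - σ) / 2)) (-α) :=
    ContinuousAt.comp (g := Real.Gamma)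
      (continuousAt_Gamma_of_ne_zero hGdα.ne') (by fun_prop)
  have hden₁ : ContinuousAt (fun σ : ℝ => Real.Gamma ((d - σ - α) / 2)) (-α) :=
    ContinuousAt.comp (g := Real.Gamma)
      (continuousAt_Gamma_of_ne_zero hGd.ne') (by fun_prop)
  have hden₂ : ContinuousAt (fun σ : ℝ => Real.Gamma (σ / 2)) (-α) :=
    ContinuousAt.comp (g := Real.Gamma) (continuousAt_Gamma_of_ne_zero hGneg.ne) (by fun_prop)
  have hreg : ContinuousAt (fun σ : ℝ => -(2 ^ α) * Real.Gamma ((d - σ) / 2) /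
      (Real.Gamma ((d - σ - α) / 2) * Real.Gamma (σ / 2))) (-α) :=
    (continuousAt_const.mul hnum).div (hden₁.mul hden₂) (mul_neg_of_pos_of_neg hGd hGneg).ne
  have hpos : 0 < -(2 ^ α) * Real.Gamma ((d - -α) / 2) /
      (Real.Gamma ((d - -α - α) / 2) * Real.Gamma (-α / 2)) :=
    div_pos_of_neg_of_neg (mul_neg_of_neg_of_pos (neg_neg_of_pos (by positivity)) hGdα)
      (mul_neg_of_pos_of_neg hGd hGneg)
  have hlin : Tendsto (fun σ : ℝ => (σ + α) / 2) (nhdsWithin (-α) (Set.Ioi (-α)))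
      (nhdsWithin 0 (Set.Ioi 0)) := by
    refine tendsto_nhdsWithin_iff.mpr ⟨?_, ?_⟩
    · have h : ContinuousAt (fun σ : ℝ => (σ + α) / 2) (-α) := by fun_prop
      simpa using h.tendsto.mono_left (nhdsWithin_le_nhds (s := Set.Ioi (-α)))
    · filter_upwards [self_mem_nhdsWithin] with σ hσ
      have hσ : -α < σ := hσ
      exact Set.mem_Ioi.mpr (by linarith)
  refine ((Gamma_tendsto_atTop_nhdsGT_zero.comp hlin).atTop_mul_pos hpos
    (hreg.tendsto.mono_left nhdsWithin_le_nhds)).congr' ?_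
  filter_upwards [nhdsWithin_le_nhds (eventually_ne_nhds (neg_ne_zero.mpr hα.ne'))] with σ hσ
  simp only [Psi, if_neg hσ, Function.comp_apply]
  ring
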